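/- Let P and Q be positive joint distributions on 𝒳 × 𝒴, fix reference points x₀ ∈ 𝒳 and y₀ ∈ 𝒴, let P* be a minimizer of min{ D(P̃‖Q) : P̃ a joint distribution with P̃_X = P_X and P̃_Y = P_Y }, and define ȷ(x,y) = log(P*(x,y)/Q(x,y)). Then: (a) for every Δ : 𝒳 × 𝒴 → ℝ with all row sums and all column sums zero (Σ_y Δ(x,y) = 0 for all x and Σ_x Δ(x,y) = 0 for all y), the function t ↦ E(P + tΔ ‖ Q) has derivative 0 at t = 0; (b) for every i ∈ 𝒳, with Δᵢ(x,y) = (1{x=i} − 1{x=x₀})·1{y=y₀}, the function t ↦ E(P + tΔᵢ ‖ Q) has derivative ȷ(i,y₀) − ȷ(x₀,y₀) at t = 0; (c) for every j ∈ 𝒴, with Δⱼ(x,y) = 1{x=x₀}·(1{y=j} − 1{y=y₀}), the function t ↦ E(P + tΔⱼ ‖ Q) has derivative ȷ(x₀,j) − ȷ(x₀,y₀) at t = 0. (In each case P + tΔ is a positive joint distribution for all t in a neighborhood of 0, so E(P + tΔ ‖ Q) is well defined there.) -/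

import Mathlib

open scoped Classical BigOperators

noncomputable section

variable {X Y : Type*} [Fintype X] [Fintype Y]

/-- `P` is a joint distribution on `X × Y`. -/
def IsDist (P : X × Y → ℝ) : Prop :=
  (∀ z, 0 ≤ P z) ∧ ∑ z : X × Y, P z = 1

/-- `P` is a positive joint distribution on `X × Y`. -/
def IsPos (P : X × Y → ℝ) : Prop :=
  (∀ z, 0 < P z) ∧ ∑ z : X × Y, P z = 1

/-- The first marginal of a joint distribution. -/
def margX (P : X × Y → ℝ) (x : X) : ℝ := ∑ y : Y, P (x, y)

/-- The second marginal of a joint distribution. -/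
def margY (P : X × Y → ℝ) (y : Y) : ℝ := ∑ x : X, P (x, y)

/-- Relative entropy `D(P‖Q)` (natural log; `Real.log 0 = 0` realizes `0·log 0 = 0`). -/
def relEnt (P Q : X × Y → ℝ) : ℝ := ∑ z : X × Y, P z * Real.log (P z / Q z)

/-- Projected relative entropy `E(P‖Q)`. -/
def projE (P Q : X × Y → ℝ) : ℝ :=
  sInf { d : ℝ | ∃ P' : X × Y → ℝ,
    IsDist P' ∧ margX P' = margX P ∧ margY P' = margY P ∧ d = relEnt P' Q }

/-- `R ∈ ℰ^{xy}(S)` : `R` has the same correlation coordinates as `S`. -/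
def SameCorr (R S : X × Y → ℝ) : Prop :=
  ∃ a1 : X → ℝ, ∃ a2 : Y → ℝ,
    ∀ x : X, ∀ y : Y, Real.log (R (x, y) / S (x, y)) = a1 x + a2 y

/-- The type (empirical distribution) of a sequence. -/
def empDist {n : ℕ} (x : Fin n → X) (a : X) : ℝ :=
  ((Finset.univ.filter fun i => x i = a).card : ℝ) / n

/-- The joint type of a pair of sequences. -/
def empJoint {n : ℕ} (x : Fin n → X) (y : Fin n → Y) (z : X × Y) : ℝ :=
  ((Finset.univ.filter fun i => x i = z.1 ∧ y i = z.2).card : ℝ) / n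

/-- Probability of a set under the `n`-fold i.i.d. product of `P`. -/
def prodProb (P : X × Y → ℝ) (n : ℕ) (A : Set ((Fin n → X) × (Fin n → Y))) : ℝ :=
  ∑ z : (Fin n → X) × (Fin n → Y),
    if z ∈ A then ∏ i : Fin n, P (z.1 i, z.2 i) else 0

/-- `P` is a joint type with denominator `n` (an element of `𝒫ₙ(𝒳 × 𝒴)`). -/
def IsTypeN (n : ℕ) (P : X × Y → ℝ) : Prop :=
  IsDist P ∧ ∀ z : X × Y, ∃ k : ℕ, P z = (k : ℝ) / n

/-- `Eₙ(P̄‖Q)` : projected relative entropy restricted to joint types. -/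
def En (n : ℕ) (Pbar Q : X × Y → ℝ) : ℝ :=
  sInf { d : ℝ | ∃ Pt : X × Y → ℝ,
    IsTypeN n Pt ∧ margX Pt = margX Pbar ∧ margY Pt = margY Pbar ∧ d = relEnt Pt Q }

/-- Standard normal cumulative distribution function `Φ`. -/
def stdNormalCDF (t : ℝ) : ℝ :=
  ∫ u in Set.Iic t, (Real.sqrt (2 * Real.pi))⁻¹ * Real.exp (-(u ^ 2) / 2)

/-- Inverse of the standard normal CDF, `Φ⁻¹`. -/
def stdNormalCDFInv (e : ℝ) : ℝ := Function.invFun stdNormalCDF e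

/-- **Gibbs' inequality**: relative entropy is nonnegative. -/
theorem relEnt_nonneg {R S : X × Y → ℝ} (hR : IsDist R) (hS : IsPos S) : 0 ≤ relEnt R S := by
  have h : ∑ z : X × Y, (R z - S z) ≤ relEnt R S := by
    refine Finset.sum_le_sum fun z _ => ?_
    rcases (hR.1 z).eq_or_lt with h0 | h0
    · simpa [← h0] using (hS.1 z).le
    · have h1 := Real.log_le_sub_one_of_pos (div_pos (hS.1 z) h0)
      have h2 : Real.log (R z / S z) = -Real.log (S z / R z) := by
        rw [← Real.log_inv, inv_div]
      have h3 : R z * (S z / R z - 1) = S z - R z := by field_simp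
      have h4 := mul_le_mul_of_nonneg_left h1 h0.le
      rw [h2]
      linarith
  rwa [Finset.sum_sub_distrib, hR.2, hS.2, sub_self] at h

theorem projE_le_relEnt {P Q R : X × Y → ℝ} (hQ : IsPos Q) (hR : IsDist R)
    (hX : margX R = margX P) (hY : margY R = margY P) : projE P Q ≤ relEnt R Q := by
  refine csInf_le ⟨0, ?_⟩ ⟨R, hR, hX, hY, rfl⟩
  rintro d ⟨S, hS, -, -, rfl⟩
  exact relEnt_nonneg hS hQ

theorem margX_add_smul {X Y : Type*} [Fintype Y] (P Δ : X × Y → ℝ) (t : ℝ) (x : X) :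
    margX (fun z => P z + t * Δ z) x = margX P x + t * ∑ y : Y, Δ (x, y) := by
  simp [margX, Finset.sum_add_distrib, Finset.mul_sum]

theorem margY_add_smul {X Y : Type*} [Fintype X] (P Δ : X × Y → ℝ) (t : ℝ) (y : Y) :
    margY (fun z => P z + t * Δ z) y = margY P y + t * ∑ x : X, Δ (x, y) := by
  simp [margY, Finset.sum_add_distrib, Finset.mul_sum]

/-- A minimizer of the relative entropy among distributions with the marginals of a positive
distribution is positive. -/
theorem isPos_of_relEnt_eq_projE {P Q R : X × Y → ℝ} (hP : IsPos P) (hQ : IsPos Q)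
    (hR : IsDist R) (hX : margX R = margX P) (hY : margY R = margY P)
    (hmin : relEnt R Q = projE P Q) : IsPos R := by
  refine ⟨fun w => (hR.1 w).lt_of_ne' fun hw => ?_, hR.2⟩
  have key : ∀ s : ℝ, 0 < s → s ≤ 1 →
      0 ≤ relEnt P Q - relEnt R Q + P w * Real.log s := by
    intro s hs hs1
    have hfeas : projE P Q ≤ relEnt (fun z => R z + s * (P z - R z)) Q := by
      refine projE_le_relEnt hQ ⟨fun z => ?_, ?_⟩ ?_ ?_
      · nlinarith [hR.1 z, (hP.1 z).le, mul_nonneg hs.le (hP.1 z).le,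
          mul_nonneg (sub_nonneg.2 hs1) (hR.1 z)]
      · rw [Finset.sum_add_distrib, ← Finset.mul_sum, Finset.sum_sub_distrib, hR.2, hP.2]
        ring
      · funext x
        have h := congrFun hX x
        rw [margX_add_smul, Finset.sum_sub_distrib]
        change margX R x + s * (margX P x - margX R x) = _
        rw [h]; ring
      · funext y
        have h := congrFun hY y
        rw [margY_add_smul, Finset.sum_sub_distrib]
        change margY R y + s * (margY P y - margY R y) = _
        rw [h]; ring
    have hlog : Real.log s ≤ 0 := Real.log_nonpos hs.le hs1
    have hconv : relEnt (fun z => R z + s * (P z - R z)) Q ≤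
        ∑ z : X × Y, ((1 - s) * (R z * Real.log (R z / Q z)) + s * (P z * Real.log (P z / Q z))
          + if z = w then s * (P z * Real.log s) else 0) := by
      refine Finset.sum_le_sum fun z _ => ?_
      have hq := hQ.1 z
      have hp := hP.1 z
      rcases (hR.1 z).eq_or_lt with h0 | h0
      · have h1 : (R z + s * (P z - R z)) * Real.log ((R z + s * (P z - R z)) / Q z)
            = s * (P z * Real.log (P z / Q z)) + s * (P z * Real.log s) := by
          rw [← h0, zero_add, sub_zero, mul_div_assoc,
            Real.log_mul hs.ne' (div_pos hp hq).ne']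
          ring
        have h2 : s * (P z * Real.log s) ≤ 0 :=
          mul_nonpos_of_nonneg_of_nonpos hs.le (mul_nonpos_of_nonneg_of_nonpos hp.le hlog)
        rw [h1, ← h0]
        split_ifs <;> simp [h2]
      · have hzw : z ≠ w := by rintro rfl; exact h0.ne' hw
        have hc := Real.convexOn_mul_log.2 (div_pos h0 hq).le (div_pos hp hq).le
          (sub_nonneg.2 hs1) hs.le (by ring)
        simp only [smul_eq_mul] at hc
        have he : (1 - s) * (R z / Q z) + s * (P z / Q z) = (R z + s * (P z - R z)) / Q z := by
          field_simp; ring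
        rw [he] at hc
        have hm := mul_le_mul_of_nonneg_left hc hq.le
        rw [if_neg hzw, add_zero]
        calc _ = Q z * ((R z + s * (P z - R z)) / Q z *
              Real.log ((R z + s * (P z - R z)) / Q z)) := by field_simp
          _ ≤ _ := hm
          _ = _ := by field_simp
    rw [Finset.sum_add_distrib, Finset.sum_add_distrib, ← Finset.mul_sum, ← Finset.mul_sum,
      Finset.sum_ite_eq' Finset.univ w, if_pos (Finset.mem_univ w)] at hconv
    change _ ≤ (1 - s) * relEnt R Q + s * relEnt P Q + _ at hconv
    have h : 0 ≤ s * (relEnt P Q - relEnt R Q + P w * Real.log s) := by linarith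
    exact nonneg_of_mul_nonneg_right h hs
  have hw := hP.1 w
  have hC : 0 ≤ relEnt P Q - relEnt R Q := by simpa using key 1 one_pos le_rfl
  have h := key (Real.exp (-((relEnt P Q - relEnt R Q + 1) / P w))) (Real.exp_pos _)
    (Real.exp_le_one_iff.2 (neg_nonpos.2 (by positivity)))
  rw [Real.log_exp, mul_neg, mul_div_cancel₀ _ hw.ne'] at h
  linarith

theorem hasDerivAt_relEnt_add_smul {R Q Δ : X × Y → ℝ} (hR : IsPos R) (hQ : IsPos Q)
    (hΔ : ∑ z : X × Y, Δ z = 0) :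
    HasDerivAt (fun t : ℝ => relEnt (fun z => R z + t * Δ z) Q)
      (∑ z : X × Y, Δ z * Real.log (R z / Q z)) 0 := by
  have h : ∀ z ∈ (Finset.univ : Finset (X × Y)),
      HasDerivAt (fun t : ℝ => (R z + t * Δ z) * Real.log ((R z + t * Δ z) / Q z))
        (Δ z * Real.log (R z / Q z) + Δ z) 0 := by
    intro z _
    have hr := (hR.1 z).ne'
    have hq := (hQ.1 z).ne'
    have h1 : HasDerivAt (fun t : ℝ => R z + t * Δ z) (Δ z) 0 := by
      simpa using ((hasDerivAt_id (0 : ℝ)).mul_const (Δ z)).const_add (R z)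
    have h2 := h1.fun_mul ((h1.div_const (Q z)).log (by simp [hr, hq]))
    refine h2.congr_deriv ?_
    simp only [zero_mul, add_zero]
    field_simp
  have hs := HasDerivAt.fun_sum h
  rw [Finset.sum_add_distrib, hΔ, add_zero] at hs
  exact hs

theorem eventually_isDist_add_smul {R Δ : X × Y → ℝ} (hR : IsPos R)
    (hΔ : ∑ z : X × Y, Δ z = 0) :
    ∀ᶠ t : ℝ in nhds 0, IsDist fun z => R z + t * Δ z := by
  have h : ∀ᶠ t : ℝ in nhds 0, ∀ z, 0 < R z + t * Δ z := by
    refine Filter.eventually_all.2 fun z => ?_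
    have hc : ContinuousAt (fun t : ℝ => R z + t * Δ z) 0 := by fun_prop
    exact hc.eventually (lt_mem_nhds (by simpa using hR.1 z))
  filter_upwards [h] with t ht
  refine ⟨fun z => (ht z).le, ?_⟩
  rw [Finset.sum_add_distrib, ← Finset.mul_sum, hΔ, hR.2, mul_zero, add_zero]

/-- The projected relative entropy density is orthogonal to every direction that preserves the
marginals. -/
theorem sum_mul_log_eq_zero {P Q R Δ : X × Y → ℝ} (hQ : IsPos Q) (hR : IsPos R)
    (hX : margX R = margX P) (hY : margY R = margY P) (hmin : relEnt R Q = projE P Q)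
    (hΔX : ∀ x : X, ∑ y : Y, Δ (x, y) = 0) (hΔY : ∀ y : Y, ∑ x : X, Δ (x, y) = 0) :
    ∑ z : X × Y, Δ z * Real.log (R z / Q z) = 0 := by
  have hΔ : ∑ z : X × Y, Δ z = 0 := by simp [Fintype.sum_prod_type, hΔX]
  refine IsLocalMin.hasDerivAt_eq_zero ?_ (hasDerivAt_relEnt_add_smul hR hQ hΔ)
  filter_upwards [eventually_isDist_add_smul hR hΔ] with t ht
  simp only [zero_mul, add_zero]
  refine hmin.trans_le (projE_le_relEnt hQ ht ?_ ?_)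
  · funext x; rw [margX_add_smul, hΔX, mul_zero, add_zero, hX]
  · funext y; rw [margY_add_smul, hΔY, mul_zero, add_zero, hY]

/-- The derivative of the projected relative entropy along `Δ` is the pairing of `Δ` with the
projected relative entropy density. -/
theorem hasDerivAt_projE_add_smul {P Q R Δ : X × Y → ℝ} (hQ : IsPos Q) (hR : IsPos R)
    (hX : margX R = margX P) (hY : margY R = margY P) (hmin : relEnt R Q = projE P Q)
    (hΔ : ∑ z : X × Y, Δ z = 0) :
    HasDerivAt (fun t : ℝ => projE (fun z => P z + t * Δ z) Q)
      (∑ z : X × Y, Δ z * Real.log (R z / Q z)) 0 := by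
  set D := ∑ z : X × Y, Δ z * Real.log (R z / Q z) with hD
  have hXt : ∀ t, margX (fun z => R z + t * Δ z) = margX (fun z => P z + t * Δ z) := fun t => by
    funext x; rw [margX_add_smul, margX_add_smul, hX]
  have hYt : ∀ t, margY (fun z => R z + t * Δ z) = margY (fun z => P z + t * Δ z) := fun t => by
    funext y; rw [margY_add_smul, margY_add_smul, hY]
  have hdist := eventually_isDist_add_smul hR hΔ
  have hupper : ∀ᶠ t : ℝ in nhds 0,
      projE (fun z => P z + t * Δ z) Q ≤ relEnt (fun z => R z + t * Δ z) Q := by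
    filter_upwards [hdist] with t ht
    exact projE_le_relEnt hQ ht (hXt t) (hYt t)
  have hlower : ∀ᶠ t : ℝ in nhds 0,
      relEnt R Q + t * D ≤ projE (fun z => P z + t * Δ z) Q := by
    filter_upwards [hdist] with t ht
    refine le_csInf ⟨_, _, ht, hXt t, hYt t, rfl⟩ ?_
    rintro d ⟨S, hS, hSX, hSY, rfl⟩
    have horth := sum_mul_log_eq_zero (Δ := fun z => S z - (R z + t * Δ z)) hQ hR hX hY hmin
      (fun x => by
        rw [Finset.sum_sub_distrib]
        exact sub_eq_zero.2 (congrFun (hSX.trans (hXt t).symm) x))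
      (fun y => by
        rw [Finset.sum_sub_distrib]
        exact sub_eq_zero.2 (congrFun (hSY.trans (hYt t).symm) y))
    have hsplit : relEnt S Q = relEnt S R + ∑ z : X × Y, S z * Real.log (R z / Q z) := by
      rw [relEnt, relEnt, ← Finset.sum_add_distrib]
      refine Finset.sum_congr rfl fun z _ => ?_
      have hr := hR.1 z
      rcases (hS.1 z).eq_or_lt with h0 | h0
      · simp [← h0]
      · rw [← mul_add, ← Real.log_mul (div_pos h0 hr).ne' (div_pos hr (hQ.1 z)).ne',
          div_mul_div_cancel₀ hr.ne']
    have hlin : ∑ z : X × Y, (S z - (R z + t * Δ z)) * Real.log (R z / Q z)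
        = ∑ z : X × Y, S z * Real.log (R z / Q z) - (relEnt R Q + t * D) := by
      rw [hD, relEnt, Finset.mul_sum, ← Finset.sum_add_distrib, ← Finset.sum_sub_distrib]
      exact Finset.sum_congr rfl fun z _ => by ring
    have := relEnt_nonneg hS hR
    linarith
  have hg := hasDerivAt_relEnt_add_smul hR hQ hΔ
  rw [hasDerivAt_iff_isLittleO] at hg ⊢
  refine Asymptotics.IsBigO.trans_isLittleO (Asymptotics.IsBigO.of_bound 1 ?_) hg
  filter_upwards [hupper, hlower] with t hu hl
  simp only [zero_mul, add_zero, sub_zero, smul_eq_mul, one_mul, Real.norm_eq_abs] at hu hl ⊢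
  rw [← hmin, ← hD]
  exact abs_le_abs_of_nonneg (by linarith) (by linarith)

/-- derivatives of the projected relative entropy along the
expectation coordinates, expressed via the projected relative entropy density. -/
theorem projE_derivatives
    [Nonempty X] [Nonempty Y]
    (P Q Ps : X × Y → ℝ) (hP : IsPos P) (hQ : IsPos Q)
    (x0 : X) (y0 : Y)
    (hPs : IsDist Ps) (hPsX : margX Ps = margX P) (hPsY : margY Ps = margY P)
    (hmin : relEnt Ps Q = projE P Q)
    (j : X × Y → ℝ) (hj : ∀ z : X × Y, j z = Real.log (Ps z / Q z)) :
    (∀ Δ : X × Y → ℝ,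
      (∀ x : X, ∑ y : Y, Δ (x, y) = 0) → (∀ y : Y, ∑ x : X, Δ (x, y) = 0) →
      HasDerivAt (fun t : ℝ => projE (fun z => P z + t * Δ z) Q) 0 0) ∧
    (∀ i : X,
      HasDerivAt
        (fun t : ℝ => projE
          (fun z => P z + t *
            (((if z.1 = i then (1 : ℝ) else 0) - (if z.1 = x0 then (1 : ℝ) else 0))
              * (if z.2 = y0 then (1 : ℝ) else 0))) Q)
        (j (i, y0) - j (x0, y0)) 0) ∧
    (∀ jY : Y,
      HasDerivAt
        (fun t : ℝ => projE
          (fun z => P z + t *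
            ((if z.1 = x0 then (1 : ℝ) else 0)
              * ((if z.2 = jY then (1 : ℝ) else 0) - (if z.2 = y0 then (1 : ℝ) else 0)))) Q)
        (j (x0, jY) - j (x0, y0)) 0) := by
  have hR := isPos_of_relEnt_eq_projE hP hQ hPs hPsX hPsY hmin
  refine ⟨fun Δ hΔX hΔY => ?_, fun i => ?_, fun jY => ?_⟩
  · have hΔ : ∑ z : X × Y, Δ z = 0 := by simp [Fintype.sum_prod_type, hΔX]
    exact (hasDerivAt_projE_add_smul hQ hR hPsX hPsY hmin hΔ).congr_deriv
      (sum_mul_log_eq_zero hQ hR hPsX hPsY hmin hΔX hΔY)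
  · convert hasDerivAt_projE_add_smul (Δ := fun z =>
      ((if z.1 = i then (1 : ℝ) else 0) - (if z.1 = x0 then (1 : ℝ) else 0))
        * (if z.2 = y0 then (1 : ℝ) else 0)) hQ hR hPsX hPsY hmin
      (by simp [Fintype.sum_prod_type]) using 1
    simp [Fintype.sum_prod_type, sub_mul, Finset.sum_sub_distrib, hj]
  · convert hasDerivAt_projE_add_smul (Δ := fun z =>
      (if z.1 = x0 then (1 : ℝ) else 0)
        * ((if z.2 = jY then (1 : ℝ) else 0) - (if z.2 = y0 then (1 : ℝ) else 0)))
      hQ hR hPsX hPsY hmin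
      (by simp [Fintype.sum_prod_type]) using 1
    simp [Fintype.sum_prod_type, sub_mul, hj]
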